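/- For any ordinal ξ, any finite set S, and any function f : Λ^e(𝒯_{ω^{ω^ξ}}) → S, there exist x ∈ S and an extended monotone map (θ,e) from 𝒯_{ω^{ω^ξ}} into itself such that f(θ(s), θ(t), e(v)) = x for all (s,t,v) ∈ Λ^e(𝒯_{ω^{ω^ξ}}). -/

import Mathlib

noncomputable section
open Ordinal

/-- `s` is a proper initial segment of `t`. -/
def SPrefix {S : Type*} (s t : List S) : Prop := s <+: t ∧ s ≠ t

/-- The maximal members of a tree of finite sequences: those with no proper extension. -/
def MaxNodes {S : Type*} (T : Set (List S)) : Set (List S) :=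
  { t ∈ T | ¬ ∃ u ∈ T, SPrefix t u }

/-- A B-tree: a set of nonempty finite sequences which, together with the empty
sequence, is downward closed under the initial segment order. -/
def IsBTree {S : Type*} (T : Set (List S)) : Prop :=
  [] ∉ T ∧ ∀ s t : List S, t ∈ T → s <+: t → s ≠ [] → s ∈ T

/-- The derived tree: members having a proper extension in `T`. -/
def treeDeriv {S : Type*} (T : Set (List S)) : Set (List S) :=
  { s ∈ T | ∃ t ∈ T, SPrefix s t }

/-- Transfinite iterates of the derivative. -/
def derivIter {S : Type*} (T : Set (List S)) (o : Ordinal.{0}) : Set (List S) :=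
  Ordinal.limitRecOn o T (fun _ ih => treeDeriv ih)
    (fun o _ ih => ⋂ p : {p : Ordinal.{0} // p < o}, ih p.1 p.2)

open scoped Classical in
/-- The order `o(T)`, with value `⊤ = ∞` for ill-founded trees. -/
def treeOrder {S : Type*} (T : Set (List S)) : WithTop Ordinal :=
  if _ : ∃ o : Ordinal.{0}, derivIter T o = ∅ then
    ↑(sInf {o : Ordinal.{0} | derivIter T o = ∅}) else ⊤

/-- A tree of finite sequences is well-founded if it has no infinite strictly
increasing chain. -/
def WellFoundedTree {S : Type*} (T : Set (List S)) : Prop :=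
  ¬ ∃ c : ℕ → List S, (∀ n, c n ∈ T) ∧ ∀ n, SPrefix (c n) (c (n + 1))

/-- A monotone map from (a tree) `T` into (a tree) `V`. -/
def MonotoneTreeMap {S₁ S₂ : Type*} (θ : List S₁ → List S₂)
    (T : Set (List S₁)) (V : Set (List S₂)) : Prop :=
  Set.MapsTo θ T V ∧ ∀ s ∈ T, ∀ t ∈ T, SPrefix s t → SPrefix (θ s) (θ t)

/-- An extended monotone map `(θ, e)` from `T` into `V`. -/
def ExtMonotoneTreeMap {S₁ S₂ : Type*} (θ e : List S₁ → List S₂)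
    (T : Set (List S₁)) (V : Set (List S₂)) : Prop :=
  MonotoneTreeMap θ T V ∧ Set.MapsTo e (MaxNodes T) (MaxNodes V) ∧
    ∀ s ∈ MaxNodes T, θ s <+: e s

/-- The B-trees `𝒯_ξ` on the ordinals: `𝒯_1 = {(1)}`,
`𝒯_{ξ+1} = {(ξ+1)} ∪ {(ξ+1)⌢t : t ∈ 𝒯_ξ}`, and `𝒯_ξ = ⋃_{η<ξ} 𝒯_{η+1}` at limits. -/
def calT : Ordinal.{0} → Set (List Ordinal.{0}) := fun ξ =>
  Ordinal.limitRecOn ξ ∅ (fun o ih => {[o + 1]} ∪ (List.cons (o + 1)) '' ih)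
    (fun o _ ih => ⋃ p : {p : Ordinal.{0} // p < o}, ih p.1 p.2)

/-- The tree product `[T₀, T₁]`: concatenations of blocks `(sᵢ, xᵢ^{(|sᵢ|)})` with
`sᵢ ∈ T₀`, all but the last `sᵢ` maximal in `T₀`, and `(xᵢ)ᵢ ∈ T₁`. -/
def treeProd {S₀ S₁ : Type*} (T₀ : Set (List S₀)) (T₁ : Set (List S₁)) :
    Set (List (S₀ × S₁)) :=
  { l | ∃ (k : ℕ) (s : Fin (k + 1) → List S₀) (x : Fin (k + 1) → S₁),
      (∀ i, s i ∈ T₀) ∧ (∀ i : Fin (k + 1), (i : ℕ) < k → s i ∈ MaxNodes T₀) ∧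
      List.ofFn x ∈ T₁ ∧
      l = (List.ofFn fun i => (s i).map fun a => (a, x i)).flatten }

/-- The member `l` of `[𝒯_{ω^ξ}, 𝒯_k]` lies on the `i`-th level, i.e. its unique block
decomposition has `i` blocks; equivalently its last second coordinate is `k - i + 1`. -/
def OnLevel (k i : ℕ) (l : List (Ordinal.{0} × Ordinal.{0})) : Prop :=
  ∃ p : Ordinal.{0} × Ordinal.{0}, l.getLast? = some p ∧ p.2 = ((k - i + 1 : ℕ) : Ordinal.{0})

/-- `U` is a unit of `[𝒯_{ω^ξ}, 𝒯_k]`: either the first level, or the set of proper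
extensions on level `i+1` of some `t` maximal in the `i`-th level. -/
def IsTPUnit (ξ : Ordinal.{0}) (k : ℕ) (U : Set (List (Ordinal.{0} × Ordinal.{0}))) : Prop :=
  U = {l ∈ treeProd (calT (omega0 ^ ξ)) (calT (k : ℕ)) | OnLevel k 1 l} ∨
  ∃ (t : List (Ordinal.{0} × Ordinal.{0})) (i : ℕ), 1 ≤ i ∧ i < k ∧
    t ∈ treeProd (calT (omega0 ^ ξ)) (calT (k : ℕ)) ∧ OnLevel k i t ∧
    (¬ ∃ u ∈ treeProd (calT (omega0 ^ ξ)) (calT (k : ℕ)), SPrefix t u ∧ OnLevel k i u) ∧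
    U = {l ∈ treeProd (calT (omega0 ^ ξ)) (calT (k : ℕ)) | SPrefix t l ∧ OnLevel k (i + 1) l}



section Game
variable {N : Type*} {V : Type*} {C : Type*}

/-- The ordinal clock game. -/
def WG {N : Type*} (β : Ordinal.{0}) (Q : List N → Prop) : Prop :=
  Q [] ∧ ∀ γ, γ < β → ∃ s, WG γ (fun l => Q (s :: l))
termination_by β

theorem WG_iff {β : Ordinal.{0}} {Q : List N → Prop} :
    WG β Q ↔ Q [] ∧ ∀ γ, γ < β → ∃ s, WG γ (fun l => Q (s :: l)) := by
  rw [WG]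

theorem WG.nil {β : Ordinal.{0}} {Q : List N → Prop} (h : WG β Q) : Q [] := (WG_iff.1 h).1

theorem WG.mono {β : Ordinal.{0}} : ∀ {Q Q' : List N → Prop}, WG β Q → (∀ l, Q l → Q' l) →
    WG β Q' := by
  induction β using WellFoundedLT.induction with
  | ind β ih =>
    intro Q Q' h hQ
    rw [WG_iff] at h ⊢
    refine ⟨hQ _ h.1, fun γ hγ => ?_⟩
    obtain ⟨s, hs⟩ := h.2 γ hγ
    exact ⟨s, ih γ hγ hs fun l => hQ _⟩

theorem WG.le {β β' : Ordinal.{0}} {Q : List N → Prop} (h : WG β Q) (hb : β' ≤ β) : WG β' Q := by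
  rw [WG_iff] at h ⊢
  exact ⟨h.1, fun γ hγ => h.2 γ (hγ.trans_le hb)⟩

theorem WG_zero {Q : List N → Prop} : WG 0 Q ↔ Q [] := by
  rw [WG_iff]; simp

theorem WG_add {δ a : Ordinal.{0}} : ∀ {Q : List N → Prop}, WG (δ + a) Q ↔
    WG a (fun l => WG δ (fun l' => Q (l ++ l'))) := by
  induction a using WellFoundedLT.induction with
  | ind a ih =>
    intro Q
    constructor
    · intro h
      rw [WG_iff]
      refine ⟨h.le (by simp), fun γ hγ => ?_⟩
      obtain ⟨s, hs⟩ := (WG_iff.1 h).2 (δ + γ) (by gcongr)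
      exact ⟨s, (ih γ hγ).1 hs⟩
    · intro h
      rw [WG_iff] at h
      rw [WG_iff]
      refine ⟨h.1.nil, fun γ hγ => ?_⟩
      rcases lt_or_ge γ δ with hd | hd
      · exact (WG_iff.1 h.1).2 γ hd
      · obtain ⟨c, rfl⟩ := exists_add_of_le hd
        have hc : c < a := by simpa using hγ
        obtain ⟨s, hs⟩ := h.2 c hc
        exact ⟨s, (ih c hc).2 hs⟩

/-- Hereditary predicates. -/
def Her (P : List N → V → Prop) : Prop := ∀ l l' v, l'.Sublist l → P l v → P l' v

theorem Her.cons {P : List N → V → Prop} (h : Her P) (s : N) :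
    Her (fun l v => P (s :: l) v) := fun _ _ v hl hp => h _ _ v (hl.cons_cons s) hp

theorem Her.and {P : List N → V → Prop} (h : Her P) (A : V → Prop) :
    Her (fun l v => P l v ∧ A v) := fun _ _ v hl hp => ⟨h _ _ v hl hp.1, hp.2⟩

theorem exists_bound [Finite C] {β : Ordinal.{0}} (hβ : β ≠ 0) (γ : C → Ordinal.{0})
    (h : ∀ x, γ x < β) : ∃ δ < β, ∀ x, γ x ≤ δ := by
  cases isEmpty_or_nonempty C
  · exact ⟨0, pos_iff_ne_zero.2 hβ, fun x => (IsEmpty.false x).elim⟩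
  · obtain ⟨x, hx⟩ := Finite.exists_max γ
    exact ⟨γ x, h x, hx⟩

theorem L0 [Finite C] (h : V → C) {β : Ordinal.{0}} : ∀ {P : List N → V → Prop}, Her P →
    WG β (fun l => ∃ v, P l v) → ∃ x, WG β (fun l => ∃ v, P l v ∧ h v = x) := by
  induction β using WellFoundedLT.induction with
  | ind β ih =>
    intro P hP hW
    by_cases hβ : β = 0
    · subst hβ
      simp only [WG_zero] at hW ⊢
      obtain ⟨v, hv⟩ := hW
      exact ⟨_, v, hv, rfl⟩
    by_contra hcon
    push Not at hcon
    have key : ∀ x, ∃ γ < β, ∀ s, ¬ WG γ (fun l => ∃ v, P (s :: l) v ∧ h v = x) := by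
      intro x
      by_contra hx
      push Not at hx
      apply hcon x
      rw [WG_iff]
      refine ⟨?_, fun γ hγ => hx γ hγ⟩
      obtain ⟨s, hs⟩ := hx 0 (pos_iff_ne_zero.2 hβ)
      obtain ⟨v, hv, hx⟩ := hs.nil
      exact ⟨v, hP _ _ v (List.nil_sublist _) hv, hx⟩
    choose γ hγ hno using key
    obtain ⟨δ, hδ, hle⟩ := exists_bound hβ γ hγ
    obtain ⟨s, hs⟩ := (WG_iff.1 hW).2 δ hδ
    obtain ⟨x, hx⟩ := ih δ hδ (hP.cons s) hs
    exact hno x s (hx.le (hle x))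

/-- Bound for the natural sum. -/
def Bd [DecidableEq C] (o : Ordinal.{0}) (z : C → Ordinal.{0}) : Prop :=
  ∀ x, ∀ y, y < z x → ∃ o', ∃ _ : o' < o, Bd o' (Function.update z x y)
termination_by o

theorem Bd_iff [DecidableEq C] {o : Ordinal.{0}} {z : C → Ordinal.{0}} : Bd o z ↔
    ∀ x, ∀ y, y < z x → ∃ o' < o, Bd o' (Function.update z x y) := by
  rw [Bd]; simp only [exists_prop]

theorem Bd_mul [Fintype C] [DecidableEq C] {ζ : Ordinal.{0}}
    (hζ : ∀ p : C → Ordinal.{0}, (∀ x, p x < ω ^ ζ) → ∃ o < ω ^ ζ, Bd o p) (M : ℕ) :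
    ∀ (o : Ordinal.{0}) (n : C → ℕ) (p : C → Ordinal.{0}), (∑ x, n x = M) → (∀ x, p x < ω ^ ζ) →
      Bd o p → Bd (ω ^ ζ * M + o) (fun x => ω ^ ζ * n x + p x) := by
  induction M using Nat.strong_induction_on with
  | _ M ihM =>
  intro o
  induction o using WellFoundedLT.induction with
  | ind o iho =>
  intro n p hn hp hb
  rw [Bd_iff] at hb ⊢
  intro x z' hz'
  have hω : ω ^ ζ ≠ 0 := (opow_pos ζ omega0_pos).ne'
  rcases lt_or_ge z' (ω ^ ζ * n x) with h | h
  · have h1 : z' / ω ^ ζ < (n x : Ordinal.{0}) := (lt_mul_iff_div_lt hω).1 h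
    obtain ⟨n', hn'⟩ := lt_omega0.1 (h1.trans (natCast_lt_omega0 _))
    rw [hn', Nat.cast_lt] at h1
    have h2 : z' % ω ^ ζ < ω ^ ζ := mod_lt _ hω
    have hp' : ∀ y, Function.update p x (z' % ω ^ ζ) y < ω ^ ζ := by
      intro y
      by_cases hy : y = x
      · subst hy; simpa using h2
      · simpa [hy] using hp y
    obtain ⟨o3, ho3, hb3⟩ := hζ _ hp'
    have hM : ∑ y, Function.update n x n' y < M := by
      rw [← hn]
      apply Finset.sum_lt_sum
      · intro y _
        by_cases hy : y = x
        · subst hy; simpa using h1.le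
        · simp [hy]
      · exact ⟨x, Finset.mem_univ _, by simpa using h1⟩
    refine ⟨ω ^ ζ * ((∑ y, Function.update n x n' y : ℕ) : Ordinal.{0}) + o3, ?_, ?_⟩
    rotate_left
    · convert ihM _ hM o3 (Function.update n x n') _ rfl hp' hb3 using 1
      ext y
      by_cases hy : y = x
      · subst hy; simp [← hn', div_add_mod]
      · simp [hy]
    · calc ω ^ ζ * ((∑ y, Function.update n x n' y : ℕ) : Ordinal.{0}) + o3
          < ω ^ ζ * ((∑ y, Function.update n x n' y : ℕ) : Ordinal.{0}) + ω ^ ζ := by gcongr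
        _ = ω ^ ζ * ((∑ y, Function.update n x n' y + 1 : ℕ) : Ordinal.{0}) := by
            rw [Nat.cast_add, mul_add]; simp
        _ ≤ ω ^ ζ * (M : Ordinal.{0}) := by
            gcongr
            exact_mod_cast hM
        _ ≤ _ := by simp
  · obtain ⟨p', rfl⟩ := exists_add_of_le h
    have hpp : p' < p x := by simpa using hz'
    obtain ⟨o', ho', hb'⟩ := hb x p' hpp
    refine ⟨ω ^ ζ * M + o', by gcongr, ?_⟩
    convert iho o' ho' n (Function.update p x p') hn ?_ hb' using 1
    · ext y
      by_cases hy : y = x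
      · subst hy; simp
      · simp [hy]
    · intro y
      by_cases hy : y = x
      · subst hy; simpa using hpp.trans (hp _)
      · simpa [hy] using hp y

theorem Bd_exists [Fintype C] [DecidableEq C] (ζ : Ordinal.{0}) :
    ∀ p : C → Ordinal.{0}, (∀ x, p x < ω ^ ζ) → ∃ o < ω ^ ζ, Bd o p := by
  induction ζ using WellFoundedLT.induction with
  | ind ζ ih =>
  intro p hp
  by_cases h0 : ζ = 0
  · subst h0
    refine ⟨0, by simp, ?_⟩
    rw [Bd_iff]
    intro x y hy
    have := hp x
    simp at this
    simp [this] at hy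
  have : ∀ x, ∃ c < ζ, ∃ n : ℕ, p x < ω ^ c * n := fun x => (lt_omega0_opow h0).1 (hp x)
  choose c hc n hn using this
  obtain ⟨d, hd, hcd⟩ := exists_bound h0 c hc
  have hω : ω ^ d ≠ 0 := (opow_pos d omega0_pos).ne'
  have : ∀ x, ∃ m : ℕ, p x / ω ^ d = m := by
    intro x
    apply lt_omega0.1
    have : p x / ω ^ d < (n x : Ordinal.{0}) := (lt_mul_iff_div_lt hω).1 ((hn x).trans_le (by
      gcongr
      · exact omega0_pos
      · exact hcd x))
    exact this.trans (natCast_lt_omega0 _)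
  choose m hm using this
  obtain ⟨o, ho, hb⟩ := ih d hd (fun x => p x % ω ^ d) (fun x => mod_lt _ hω)
  have := Bd_mul (ih d hd) _ o m _ rfl (fun x => mod_lt _ hω) hb
  refine ⟨ω ^ d * ((∑ x, m x : ℕ) : Ordinal.{0}) + o, ?_, ?_⟩
  rotate_left
  · convert this using 1
    ext x
    rw [← hm, div_add_mod]
  · refine (lt_omega0_opow h0).2 ⟨d, hd, ∑ x, m x + 1, ?_⟩
    rw [Nat.cast_add, mul_add]
    simpa using ho

theorem WG_of_not {β : Ordinal.{0}} {Q : List N → Prop} (h0 : Q []) (h : ¬ WG β Q) :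
    ∃ γ < β, ∀ s, ¬ WG γ (fun l => Q (s :: l)) := by
  by_contra hx
  push Not at hx
  exact h (WG_iff.2 ⟨h0, hx⟩)

theorem L1gen [Fintype C] [DecidableEq C] [Nonempty C] (g : N → V → C) (o : Ordinal.{0}) :
    ∀ (z : C → Ordinal.{0}) (P : List N → V → Prop), Her P → Bd o z →
    WG o (fun l => ∃ v, P l v) → ∃ x, WG (z x) (fun l => ∃ v, P l v ∧ ∀ s ∈ l, g s v = x) := by
  induction o using WellFoundedLT.induction with
  | ind o ih =>
  intro z P hP hb hW
  by_contra hcon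
  push Not at hcon
  have key : ∀ x, ∃ γ < z x, ∀ s, ¬ WG γ (fun l => ∃ v, P (s :: l) v ∧ ∀ t ∈ s :: l, g t v = x) := by
    intro x
    refine WG_of_not ?_ (hcon x)
    obtain ⟨v, hv⟩ := hW.nil
    exact ⟨v, hv, by simp⟩
  choose γ hγ hno using key
  rw [Bd_iff] at hb
  choose o' ho' hb' using fun x => hb x (γ x) (hγ x)
  have ho : o ≠ 0 := by
    rintro rfl
    exact absurd (ho' (Classical.arbitrary C)) (by simp)
  obtain ⟨δ, hδ, hle⟩ := exists_bound ho o' ho'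
  obtain ⟨s, hs⟩ := (WG_iff.1 hW).2 δ hδ
  obtain ⟨x, hx⟩ := L0 (fun v => g s v) (hP.cons s) hs
  obtain ⟨y, hy⟩ := ih (o' x) (ho' x) _ _ ((hP.cons s).and _) (hb' x) (hx.le (hle x))
  by_cases hxy : y = x
  · subst hxy
    rw [Function.update_self] at hy
    refine hno y s (hy.mono ?_)
    rintro l ⟨v, ⟨hp, h1⟩, h2⟩
    exact ⟨v, hp, by simpa using ⟨h1, h2⟩⟩
  · rw [Function.update_of_ne hxy] at hy
    refine hcon y (hy.mono ?_)
    rintro l ⟨v, ⟨hp, h1⟩, h2⟩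
    exact ⟨v, hP _ _ v (List.sublist_cons_self _ _) hp, h2⟩

theorem WG_limit {β : Ordinal.{0}} (hβ : Order.IsSuccLimit β) {Q : List N → Prop}
    (h : ∀ γ < β, WG γ Q) : WG β Q := by
  rw [WG_iff]
  refine ⟨(h 0 hβ.bot_lt).nil, fun γ hγ => ?_⟩
  exact (WG_iff.1 (h _ (hβ.succ_lt hγ))).2 γ (Order.lt_succ γ)

theorem opow_lim {ζ : Ordinal.{0}} (h : ζ ≠ 0) : Order.IsSuccLimit (ω ^ ζ) :=
  isSuccLimit_opow_left isSuccLimit_omega0 h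

theorem L1 [Finite C] [Nonempty C] (g : N → V → C) (ζ : Ordinal.{0})
    {P : List N → V → Prop} (hP : Her P) (hW : WG (ω ^ ζ) (fun l => ∃ v, P l v)) :
    ∃ x, WG (ω ^ ζ) (fun l => ∃ v, P l v ∧ ∀ s ∈ l, g s v = x) := by
  classical
  have := Fintype.ofFinite C
  by_cases h0 : ζ = 0
  · subst h0
    rw [opow_zero] at hW ⊢
    obtain ⟨s, hs⟩ := (WG_iff.1 hW).2 0 zero_lt_one
    obtain ⟨v, hv⟩ := hs.nil
    refine ⟨g s v, ?_⟩
    rw [WG_iff]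
    refine ⟨⟨v, hP _ _ v (List.nil_sublist _) hv, by simp⟩, fun γ hγ => ⟨s, ?_⟩⟩
    have : γ = 0 := by simpa using hγ
    subst this
    rw [WG_zero]
    exact ⟨v, hv, by simp⟩
  · by_contra hcon
    push Not at hcon
    have key : ∀ x, ∃ γ < ω ^ ζ, ¬ WG γ (fun l => ∃ v, P l v ∧ ∀ s ∈ l, g s v = x) := by
      intro x
      by_contra hx
      push Not at hx
      exact hcon x (WG_limit (opow_lim h0) hx)
    choose γ hγ hno using key
    obtain ⟨o, ho, hb⟩ := Bd_exists ζ γ hγ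
    obtain ⟨x, hx⟩ := L1gen g o γ P hP hb (hW.le ho.le)
    exact hno x hx

/-- freezing finitely many values -/
theorem freeze [Finite C] [Nonempty C] {I : Type*} (h : V → I → C) (L : List I) {β : Ordinal.{0}}
    {P : List N → V → Prop} (hP : Her P) (hW : WG β (fun l => ∃ v, P l v)) :
    ∃ ψ : I → C, WG β (fun l => ∃ v, P l v ∧ ∀ i ∈ L, h v i = ψ i) := by
  classical
  obtain ⟨x, hx⟩ := L0 (fun v => fun i : {i // i ∈ L} => h v i) hP hW
  refine ⟨fun i => if hi : i ∈ L then x ⟨i, hi⟩ else Classical.arbitrary C, hx.mono ?_⟩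
  rintro l ⟨v, hp, rfl⟩
  exact ⟨v, hp, fun i hi => by simp [hi]⟩

theorem F3 [Fintype C] [DecidableEq C] [Nonempty C] (ζ : Ordinal.{0}) (n : ℕ) :
    ∀ (m : C → ℕ) (P : List N → List N → (N → N → C) → Prop),
    (∀ u u' l l' φ, u'.Sublist u → l'.Sublist l → P u l φ → P u' l' φ) →
    (∑ x, m x = n) →
    WG (ω ^ ζ) (fun u => WG (ω ^ ζ * n) (fun l => ∃ φ, P u l φ)) →
    ∃ x, WG (ω ^ ζ) (fun u => WG (ω ^ ζ * m x) (fun l => ∃ φ, P u l φ ∧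
      ∀ s ∈ u, ∀ t ∈ l, φ s t = x)) := by
  induction n with
  | zero =>
    intro m P hP hm hW
    have : m (Classical.arbitrary C) = 0 := by
      have := (Finset.sum_eq_zero_iff.1 hm) (Classical.arbitrary C) (Finset.mem_univ _)
      exact this
    refine ⟨Classical.arbitrary C, ?_⟩
    rw [this]
    refine hW.mono fun u hu => ?_
    simp only [Nat.cast_zero, mul_zero, WG_zero] at hu ⊢
    obtain ⟨φ, h⟩ := hu
    exact ⟨φ, h, by simp⟩
  | succ n ih =>
    intro m P hP hm hW
    by_cases hz : ∃ x, m x = 0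
    · obtain ⟨x, hx⟩ := hz
      refine ⟨x, ?_⟩
      rw [hx]
      refine hW.mono fun u hu => ?_
      simp only [Nat.cast_zero, mul_zero, WG_zero] at hu ⊢
      obtain ⟨φ, h⟩ := hu.nil
      exact ⟨φ, h, by simp⟩
    push Not at hz
    have hsplit : ∀ k : ℕ, ω ^ ζ * ((k + 1 : ℕ) : Ordinal.{0}) = ω ^ ζ + ω ^ ζ * k := by
      intro k
      rw [add_comm, Nat.cast_add, mul_add]; simp
    let A : List N → List N → (N → C) → (N → N → C) → Prop := fun u l d ψ =>
      WG (ω ^ ζ) (fun u' => ∃ φ, P u (l ++ u') φ ∧ (∀ s ∈ u, ∀ t ∈ u', φ s t = d s) ∧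
        ∀ s ∈ u, ∀ t ∈ l, φ s t = ψ s t)
    have hA : ∀ u u' l l' d ψ, u'.Sublist u → l'.Sublist l → A u l d ψ → A u' l' d ψ := by
      intro u u' l l' d ψ hu hl h
      refine h.mono ?_
      rintro w ⟨φ, h1, h2, h3⟩
      exact ⟨φ, hP _ _ _ _ φ hu (hl.append_right w) h1,
        fun s hs => h2 s (hu.subset hs), fun s hs t ht => h3 s (hu.subset hs) t (hl.subset ht)⟩
    have step1 : WG (ω ^ ζ) (fun u => WG (ω ^ ζ * n) (fun l => ∃ q : (N → C) × (N → N → C),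
        A u l q.1 q.2)) := by
      refine hW.mono fun u hu => ?_
      rw [hsplit, WG_add] at hu
      refine hu.mono fun l hl => ?_
      have hH : Her (fun u' φ => P u (l ++ u') φ) :=
        fun w w' φ hw h => hP _ _ _ _ φ (List.Sublist.refl _) (hw.append_left l) h
      have hfin : Finite {i // i ∈ u} := List.finite_toSet u
      obtain ⟨d, hd⟩ := L1 (fun (t : N) (φ : N → N → C) => fun i : {i // i ∈ u} => φ i t) ζ hH hl
      have hH2 : Her (fun u' φ => P u (l ++ u') φ ∧
          ∀ t ∈ u', (fun i : {i // i ∈ u} => φ i t) = d) :=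
        fun w w' φ hw h => ⟨hH _ _ φ hw h.1, fun t ht => h.2 t (hw.subset ht)⟩
      obtain ⟨ψ, hψ⟩ := freeze (fun (φ : N → N → C) (i : N × N) => φ i.1 i.2) (u ×ˢ l) hH2 hd
      classical
      refine ⟨(fun i => if hi : i ∈ u then d ⟨i, hi⟩ else Classical.arbitrary C,
        fun s t => ψ (s, t)), hψ.mono ?_⟩
      rintro w ⟨φ, ⟨h1, h2⟩, h3⟩
      refine ⟨φ, h1, fun s hs t ht => ?_, fun s hs t ht => ?_⟩
      · simp [hs, ← h2 t ht]
      · exact h3 (s, t) (List.mem_product.2 ⟨hs, ht⟩)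
    have step2 : WG (ω ^ ζ) (fun u => ∃ d, WG (ω ^ ζ * n) (fun l => ∃ ψ, A u l d ψ)) := by
      refine step1.mono fun u hu => ?_
      have hH : Her (fun l (q : (N → C) × (N → N → C)) => A u l q.1 q.2) :=
        fun w w' q hw h => hA _ _ _ _ _ _ (List.Sublist.refl _) hw h
      obtain ⟨d, hd⟩ := freeze (fun (q : (N → C) × (N → N → C)) (i : N) => q.1 i) u hH hu
      refine ⟨d, hd.mono ?_⟩
      rintro l ⟨q, h1, h2⟩
      refine ⟨q.2, h1.mono ?_⟩
      rintro w ⟨φ, h3, h4, h5⟩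
      exact ⟨φ, h3, fun s hs t ht => (h4 s hs t ht).trans (h2 s hs), h5⟩
    obtain ⟨x, hx⟩ := L1 (fun (s : N) (d : N → C) => d s) ζ
      (P := fun u d => WG (ω ^ ζ * n) (fun l => ∃ ψ, A u l d ψ))
      (fun w w' d hw h => h.mono (by
        rintro l ⟨ψ, h⟩
        exact ⟨ψ, hA _ _ _ _ _ _ hw (List.Sublist.refl _) h⟩)) step2
    have step3 : WG (ω ^ ζ) (fun u => WG (ω ^ ζ * n) (fun l => ∃ ψ, A u l (fun _ => x) ψ)) := by
      refine hx.mono ?_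
      rintro u ⟨d, h1, h2⟩
      refine h1.mono ?_
      rintro l ⟨ψ, h⟩
      refine ⟨ψ, h.mono ?_⟩
      rintro w ⟨φ, h3, h4, h5⟩
      exact ⟨φ, h3, fun s hs t ht => (h4 s hs t ht).trans (h2 s hs), h5⟩
    have hsum : ∑ y, Function.update m x (m x - 1) y = n := by
      have h1 := Finset.sum_update_of_mem (Finset.mem_univ x) m (m x - 1)
      have h2 := Finset.sum_update_of_mem (Finset.mem_univ x) m (m x)
      rw [Function.update_eq_self] at h2
      have := Nat.pos_of_ne_zero (hz x)
      omega
    obtain ⟨y, hy⟩ := ih _ (fun u l ψ => A u l (fun _ => x) ψ)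
      (fun u u' l l' φ hu hl h => hA _ _ _ _ _ _ hu hl h) hsum step3
    refine ⟨y, hy.mono fun u hu => ?_⟩
    by_cases hxy : y = x
    · subst hxy
      rw [Function.update_self] at hu
      have : m y = (m y - 1) + 1 := by have := Nat.pos_of_ne_zero (hz y); omega
      rw [this, hsplit, WG_add]
      refine hu.mono ?_
      rintro l ⟨ψ, h1, h2⟩
      refine h1.mono ?_
      rintro w ⟨φ, h3, h4, h5⟩
      refine ⟨φ, h3, fun s hs t ht => ?_⟩
      rcases List.mem_append.1 ht with ht | ht
      · rw [h5 s hs t ht, h2 s hs t ht]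
      · exact h4 s hs t ht
    · rw [Function.update_of_ne hxy] at hu
      refine hu.mono ?_
      rintro l ⟨ψ, h1, h2⟩
      obtain ⟨φ, h3, h4, h5⟩ := h1.nil
      rw [List.append_nil] at h3
      exact ⟨φ, h3, fun s hs t ht => by rw [h5 s hs t ht, h2 s hs t ht]⟩

/-- homogeneous -/
def HG (P : List N → (N → N → C) → Prop) (x : C) (l : List N) : Prop :=
  ∃ φ, P l φ ∧ l.Pairwise (fun s t => φ s t = x)

theorem ZZ [Fintype C] [DecidableEq C] [Nonempty C] (δ : Ordinal.{0}) (z z' : C → Ordinal.{0})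
    (hI : ∀ x, ∀ P : List N → (N → N → C) → Prop, Her P → WG (ω ^ δ) (fun l => ∃ φ, P l φ) →
      ∃ y, WG (ω ^ (Function.update z x (z' x) y)) (HG P y)) (n : ℕ) :
    ∀ k : C → ℕ, (∑ x, k x = n) → ∃ K : ℕ, ∀ P : List N → (N → N → C) → Prop, Her P →
      WG (ω ^ δ * K) (fun l => ∃ φ, P l φ) →
      (∃ x, WG (ω ^ z' x * k x) (HG P x)) ∨ (∃ x, WG (ω ^ z x) (HG P x)) := by
  have triv : ∀ k : C → ℕ, (∃ x, k x = 0) → ∃ K : ℕ, ∀ P : List N → (N → N → C) → Prop, Her P →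
      WG (ω ^ δ * K) (fun l => ∃ φ, P l φ) →
      (∃ x, WG (ω ^ z' x * k x) (HG P x)) ∨ (∃ x, WG (ω ^ z x) (HG P x)) := by
    rintro k ⟨x, hx⟩
    refine ⟨0, fun P hP hW => Or.inl ⟨x, ?_⟩⟩
    simp only [hx, Nat.cast_zero, mul_zero, WG_zero] at hW ⊢
    obtain ⟨φ, h⟩ := hW
    exact ⟨φ, h, List.Pairwise.nil⟩
  induction n with
  | zero =>
    intro k hk
    exact triv k ⟨Classical.arbitrary C,
      (Finset.sum_eq_zero_iff.1 hk) (Classical.arbitrary C) (Finset.mem_univ _)⟩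
  | succ n ih =>
    intro k hk
    by_cases hz : ∃ x, k x = 0
    · exact triv k hz
    push Not at hz
    have hsum : ∀ x, ∑ y, Function.update k x (k x - 1) y = n := by
      intro x
      have h1 := Finset.sum_update_of_mem (Finset.mem_univ x) k (k x - 1)
      have h2 := Finset.sum_update_of_mem (Finset.mem_univ x) k (k x)
      rw [Function.update_eq_self] at h2
      have := Nat.pos_of_ne_zero (hz x)
      omega
    choose Kx hKx using fun x => ih _ (hsum x)
    refine ⟨∑ x, Kx x + 1, fun P hP hW => ?_⟩
    by_cases hb : ∃ x, WG (ω ^ z x) (HG P x)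
    · exact Or.inr hb
    left
    push Not at hb
    have hsplit : ∀ (a : Ordinal.{0}) (k : ℕ), a * ((k + 1 : ℕ) : Ordinal.{0}) = a * k + a := by
      intro a k
      rw [Nat.cast_add, mul_add]; simp
    rw [hsplit, WG_add] at hW
    obtain ⟨x, hx⟩ := F3 δ _ Kx (fun u l φ => P (u ++ l) φ)
      (fun u u' l l' φ hu hl h => hP _ _ φ (hu.append hl) h) rfl hW
    let Pu : List N → List N → (N → N → C) → Prop := fun u l φ =>
      P (u ++ l) φ ∧ ∀ s ∈ u, ∀ t ∈ l, φ s t = x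
    have hPu : ∀ u u' l l' φ, u'.Sublist u → l'.Sublist l → Pu u l φ → Pu u' l' φ :=
      fun u u' l l' φ hu hl h => ⟨hP _ _ φ (hu.append hl) h.1,
        fun s hs t ht => h.2 s (hu.subset hs) t (hl.subset ht)⟩
    have hPuP : ∀ u l φ, Pu u l φ → P l φ := fun u l φ h =>
      hP _ _ φ (List.sublist_append_right _ _) h.1
    have step1 : WG (ω ^ δ) (fun u => ∃ y,
        WG (ω ^ z' y * (Function.update k x (k x - 1) y : ℕ)) (HG (Pu u) y)) := by
      refine hx.mono fun u hu => ?_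
      rcases hKx x (Pu u) (fun l l' φ hl h => hPu _ _ _ _ _ (List.Sublist.refl _) hl h) hu with h | h
      · exact h
      · obtain ⟨y, hy⟩ := h
        refine absurd (hy.mono ?_) (hb y)
        rintro l ⟨φ, h1, h2⟩
        exact ⟨φ, hPuP _ _ _ h1, h2⟩
    obtain ⟨y, hy⟩ := L0 (fun y : C => y) (by
      intro u u' y hu h
      refine h.mono ?_
      rintro l ⟨φ, h1, h2⟩
      exact ⟨φ, hPu _ _ _ _ _ hu (List.Sublist.refl _) h1, h2⟩) step1
    by_cases hxy : y = x
    · subst hxy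
      refine ⟨y, ?_⟩
      let B : List N → (N → N → C) → Prop := fun u ψ =>
        WG (ω ^ z' y * (k y - 1 : ℕ)) (fun l => ∃ φ, (Pu u l φ ∧ l.Pairwise (fun s t => φ s t = y)) ∧
          ∀ s ∈ u, ∀ t ∈ u, φ s t = ψ s t)
      have hB : Her B := by
        intro u u' ψ hu h
        refine h.mono ?_
        rintro l ⟨φ, ⟨h1, h2⟩, h3⟩
        exact ⟨φ, ⟨hPu _ _ _ _ _ hu (List.Sublist.refl _) h1, h2⟩,
          fun s hs t ht => h3 s (hu.subset hs) t (hu.subset ht)⟩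
      have step2 : WG (ω ^ δ) (fun u => ∃ ψ, B u ψ) := by
        refine hy.mono ?_
        rintro u ⟨y', h1, rfl⟩
        rw [Function.update_self] at h1
        obtain ⟨ψ, hψ⟩ := freeze (fun (φ : N → N → C) (i : N × N) => φ i.1 i.2) (u ×ˢ u)
          (P := fun l φ => Pu u l φ ∧ l.Pairwise (fun s t => φ s t = y'))
          (fun l l' φ hl h => ⟨hPu _ _ _ _ _ (List.Sublist.refl _) hl h.1, h.2.sublist hl⟩) h1
        refine ⟨fun s t => ψ (s, t), hψ.mono ?_⟩
        rintro l ⟨φ, h1, h2⟩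
        exact ⟨φ, h1, fun s hs t ht => h2 (s, t) (List.mem_product.2 ⟨hs, ht⟩)⟩
      obtain ⟨y', hy'⟩ := hI y B hB step2
      by_cases hyy : y' = y
      · subst hyy
        rw [Function.update_self] at hy'
        have : k y' = (k y' - 1) + 1 := by have := Nat.pos_of_ne_zero (hz y'); omega
        rw [this, hsplit, WG_add]
        refine hy'.mono ?_
        rintro u ⟨ψ, h1, h2⟩
        refine h1.mono ?_
        rintro l ⟨φ, ⟨h3, h4⟩, h5⟩
        refine ⟨φ, h3.1, List.pairwise_append.2 ⟨?_, h4, h3.2⟩⟩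
        exact h2.imp_of_mem fun hs ht h => (h5 _ hs _ ht).trans h
      · rw [Function.update_of_ne hyy] at hy'
        refine absurd (hy'.mono ?_) (hb y')
        rintro u ⟨ψ, h1, h2⟩
        obtain ⟨φ, ⟨h3, h4⟩, h5⟩ := h1.nil
        refine ⟨φ, by simpa using h3.1, ?_⟩
        exact h2.imp_of_mem fun hs ht h => (h5 _ hs _ ht).trans h
    · refine ⟨y, ?_⟩
      obtain ⟨y', h1, rfl⟩ := hy.nil
      rw [Function.update_of_ne hxy] at h1
      refine h1.mono ?_
      rintro l ⟨φ, h1, h2⟩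
      exact ⟨φ, hPuP _ _ _ h1, h2⟩

theorem main_gen [Fintype C] [DecidableEq C] [Nonempty C] (o : Ordinal.{0}) :
    ∀ (z : C → Ordinal.{0}) (P : List N → (N → N → C) → Prop), Her P → Bd o z →
    WG (ω ^ o) (fun l => ∃ φ, P l φ) → ∃ x, WG (ω ^ z x) (HG P x) := by
  induction o using WellFoundedLT.induction with
  | ind o ih =>
  intro z P hP hb hW
  by_contra hcon
  push Not at hcon
  have hz : ∀ x, z x ≠ 0 := by
    intro x hx
    apply hcon x
    rw [hx, opow_zero, WG_iff]
    obtain ⟨φ, h⟩ := hW.nil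
    refine ⟨⟨φ, h, List.Pairwise.nil⟩, fun γ hγ => ?_⟩
    have : γ = 0 := by simpa using hγ
    subst this
    obtain ⟨s, hs⟩ := (WG_iff.1 hW).2 0 (opow_pos _ omega0_pos)
    obtain ⟨φ, h⟩ := hs.nil
    refine ⟨s, ?_⟩
    rw [WG_zero]
    exact ⟨φ, h, List.pairwise_singleton _ _⟩
  have key : ∀ x, ∃ c < z x, ∃ n : ℕ, ¬ WG (ω ^ c * n) (HG P x) := by
    intro x
    by_contra hx
    push Not at hx
    refine hcon x (WG_limit (opow_lim (hz x)) fun γ hγ => ?_)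
    obtain ⟨c, hc, n, hn⟩ := (lt_omega0_opow (hz x)).1 hγ
    exact (hx c hc n).le hn.le
  choose z' hz' k hno using key
  rw [Bd_iff] at hb
  choose o' ho' hb' using fun x => hb x (z' x) (hz' x)
  have ho : o ≠ 0 := by
    rintro rfl
    exact absurd (ho' (Classical.arbitrary C)) (by simp)
  obtain ⟨δ, hδ, hle⟩ := exists_bound ho o' ho'
  obtain ⟨K, hK⟩ := ZZ (N := N) δ z z' (fun x P hP hW => ih (o' x) (ho' x) _ P hP (hb' x)
    (hW.le (opow_le_opow_right omega0_pos (hle x)))) _ k rfl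
  have hlt : ω ^ δ * K < ω ^ o :=
    (lt_omega0_opow ho).2 ⟨δ, hδ, K + 1, by
      have : (0 : Ordinal.{0}) < ω ^ δ := opow_pos _ omega0_pos
      gcongr
      simp⟩
  rcases hK P hP (hW.le hlt.le) with ⟨x, h⟩ | ⟨x, h⟩
  · exact hno x h
  · exact hcon x h

theorem main_game [Finite C] [Nonempty C] (ξ : Ordinal.{0}) (f : N → N → V → C)
    (P : List N → V → Prop) (hP : Her P) (hW : WG (ω ^ ω ^ ξ) (fun l => ∃ v, P l v)) :
    ∃ x, WG (ω ^ ω ^ ξ) (fun l => ∃ v, P l v ∧ l.Pairwise (fun s t => f s t v = x)) := by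
  classical
  have := Fintype.ofFinite C
  let P' : List N → (N → N → C) → Prop := fun l φ => ∃ v, P l v ∧ φ = fun s t => f s t v
  have hP' : Her P' := by
    rintro l l' φ hl ⟨v, h, rfl⟩
    exact ⟨v, hP _ _ v hl h, rfl⟩
  have h0 : ω ^ ξ ≠ 0 := (opow_pos _ omega0_pos).ne'
  suffices h : ∃ x, WG (ω ^ ω ^ ξ) (HG P' x) by
    obtain ⟨x, hx⟩ := h
    refine ⟨x, hx.mono ?_⟩
    rintro l ⟨φ, ⟨v, h, rfl⟩, h2⟩
    exact ⟨v, h, h2⟩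
  by_contra hcon
  push Not at hcon
  by_cases hξ : ξ = 0
  · subst hξ
    have key : ∀ x, ∃ n : ℕ, ¬ WG ((n : ℕ) : Ordinal.{0}) (HG P' x) := by
      intro x
      by_contra hx
      push Not at hx
      refine hcon x (WG_limit (opow_lim h0) fun γ hγ => ?_)
      rw [opow_zero, opow_one] at hγ
      obtain ⟨n, rfl⟩ := lt_omega0.1 hγ
      exact hx n
    choose k hno using key
    obtain ⟨K, hK⟩ := ZZ (N := N) (0 : Ordinal.{0}) (fun _ : C => (1 : Ordinal.{0}))
      (fun _ => 0) (fun x P hP hW => ⟨x, by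
        rw [Function.update_self]
        rw [opow_zero] at hW ⊢
        rw [WG_iff]
        obtain ⟨φ, h⟩ := hW.nil
        refine ⟨⟨φ, h, List.Pairwise.nil⟩, fun γ hγ => ?_⟩
        have : γ = 0 := by simpa using hγ
        subst this
        obtain ⟨s, hs⟩ := (WG_iff.1 hW).2 0 zero_lt_one
        obtain ⟨φ, h⟩ := hs.nil
        refine ⟨s, ?_⟩
        rw [WG_zero]
        exact ⟨φ, h, List.pairwise_singleton _ _⟩⟩) _ k rfl
    have hW2 : WG (ω ^ (0 : Ordinal.{0}) * (K : Ordinal.{0})) (fun l => ∃ φ, P' l φ) := by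
      rw [opow_zero, one_mul]
      refine (hW.le ?_).mono ?_
      · rw [opow_zero, opow_one]
        exact (natCast_lt_omega0 K).le
      · rintro l ⟨v, h⟩
        exact ⟨_, v, h, rfl⟩
    rcases hK P' hP' hW2 with ⟨x, h⟩ | ⟨x, h⟩
    · exact hno x (by simpa using h)
    · exact hcon x (by simpa using h)
  have key : ∀ x, ∃ c < ω ^ ξ, ¬ WG (ω ^ c) (HG P' x) := by
    intro x
    by_contra hx
    push Not at hx
    refine hcon x (WG_limit (opow_lim h0) fun γ hγ => ?_)
    obtain ⟨c, hc, n, hn⟩ := (lt_omega0_opow h0).1 hγ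
    refine (hx (Order.succ c) ((opow_lim hξ).succ_lt hc)).le ?_
    exact (lt_omega0_opow_succ.2 ⟨n, hn⟩).le
  choose z hz hno using key
  obtain ⟨o, ho, hb⟩ := Bd_exists ξ z hz
  obtain ⟨x, hx⟩ := main_gen o z P' hP' hb ((hW.le (opow_le_opow_right omega0_pos ho.le)).mono (by
    rintro l ⟨v, h⟩
    exact ⟨_, v, h, rfl⟩))
  exact hno x hx

end Game

theorem calT_zero : calT 0 = ∅ := by
  simp [calT]

theorem calT_succ (o : Ordinal.{0}) :
    calT (o + 1) = {[o + 1]} ∪ (List.cons (o + 1)) '' calT o := by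
  simp only [calT, limitRecOn_add_one]

theorem calT_limit (o : Ordinal.{0}) (h : Order.IsSuccLimit o) :
    calT o = ⋃ p : {p : Ordinal.{0} // p < o}, calT p.1 := by
  simp only [calT]
  rw [limitRecOn_limit _ _ _ _ h]

theorem mem_limit {o : Ordinal.{0}} (h : Order.IsSuccLimit o) {t : List Ordinal.{0}} :
    t ∈ calT o ↔ ∃ p < o, t ∈ calT p := by
  rw [calT_limit o h]; simp

theorem nil_notMem (β : Ordinal.{0}) : [] ∉ calT β := by
  induction β using Ordinal.limitRecOn with
  | zero => simp [calT_zero]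
  | add_one o ih => simp [calT_succ]
  | limit o ho ih =>
    rw [mem_limit ho]
    rintro ⟨p, hp, h⟩
    exact ih p hp h

theorem cons_mem {β : Ordinal.{0}} : ∀ {a : Ordinal.{0}} {t : List Ordinal.{0}}, a :: t ∈ calT β →
    ∃ γ < β, a = γ + 1 ∧ (t = [] ∨ t ∈ calT γ) := by
  induction β using Ordinal.limitRecOn with
  | zero => simp [calT_zero]
  | add_one o ih =>
    intro a t h
    rw [calT_succ] at h
    refine ⟨o, by simp, ?_⟩
    rcases h with h | ⟨u, hu, h⟩
    · simp only [Set.mem_singleton_iff, List.cons.injEq] at h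
      exact ⟨h.1, Or.inl h.2⟩
    · simp only [List.cons.injEq] at h
      exact ⟨h.1.symm, Or.inr (h.2 ▸ hu)⟩
  | limit o ho ih =>
    intro a t h
    rw [mem_limit ho] at h
    obtain ⟨p, hp, h⟩ := h
    obtain ⟨γ, hγ, h⟩ := ih p hp h
    exact ⟨γ, hγ.trans hp, h⟩

theorem cone {β : Ordinal.{0}} : ∀ γ < β, ∃ q ∈ calT β, ∀ t, t ≠ [] →
    (q ++ t ∈ calT β ↔ t ∈ calT γ) := by
  induction β using Ordinal.limitRecOn with
  | zero => simp
  | add_one o ih =>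
    intro γ hγ
    have base : ∀ t, t ≠ [] → ((o + 1) :: t ∈ calT (o + 1) ↔ t ∈ calT o) := by
      intro t ht
      rw [calT_succ]; simp [ht]
    rcases (Order.lt_add_one_iff.1 hγ).eq_or_lt with rfl | h
    · exact ⟨[γ + 1], by rw [calT_succ]; simp, base⟩
    · obtain ⟨q, hq, h⟩ := ih γ h
      have hq0 : q ≠ [] := fun h => nil_notMem o (h ▸ hq)
      refine ⟨(o + 1) :: q, (base q hq0).2 hq, fun t ht => ?_⟩
      rw [← h t ht, List.cons_append, base _ (by simp [hq0])]
  | limit o ho ih =>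
    intro γ hγ
    have h1 : γ + 1 < o := ho.succ_lt hγ
    refine ⟨[γ + 1], (mem_limit ho).2 ⟨γ + 1, h1, by rw [calT_succ]; simp⟩, fun t ht => ⟨?_, ?_⟩⟩
    · intro h
      obtain ⟨γ', _, h2, h3⟩ := cons_mem h
      have : γ = γ' := by simpa using h2
      subst this
      exact h3.resolve_left ht
    · intro h
      exact (mem_limit ho).2 ⟨γ + 1, h1, by rw [calT_succ]; simp [h]⟩

theorem SPrefix.trans' {S : Type*} {a b c : List S} (h : SPrefix a b) (h2 : b <+: c) :
    SPrefix a c := by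
  refine ⟨h.1.trans h2, ?_⟩
  rintro rfl
  exact h.2 (h.1.eq_of_length (le_antisymm h.1.length_le h2.length_le))

theorem sprefix_append {S : Type*} {p q : List S} (hq : q ≠ []) : SPrefix p (p ++ q) :=
  ⟨List.prefix_append _ _, by simpa using hq⟩

theorem start (α β : Ordinal.{0}) : ∀ p : List Ordinal.{0}, (p ≠ [] → p ∈ calT α) →
    (β = 0 → p ≠ []) → (∀ t, t ≠ [] → (p ++ t ∈ calT α ↔ t ∈ calT β)) →
    WG β (fun l => ∃ v, v ∈ MaxNodes (calT α) ∧ p <+: v ∧ l.Pairwise SPrefix ∧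
      ∀ s ∈ l, SPrefix p s ∧ s ∈ calT α ∧ s <+: v) := by
  induction β using WellFoundedLT.induction with
  | ind β ih =>
  intro p hp h0 hc
  have key : ∀ γ < β, ∃ s, WG γ (fun l => ∃ v, v ∈ MaxNodes (calT α) ∧ p <+: v ∧
      (s :: l).Pairwise SPrefix ∧ ∀ r ∈ s :: l, SPrefix p r ∧ r ∈ calT α ∧ r <+: v) := by
    intro γ hγ
    obtain ⟨q, hq, hq2⟩ := cone γ hγ
    have hq0 : q ≠ [] := fun h => nil_notMem _ (h ▸ hq)
    have hpq : p ++ q ∈ calT α := (hc q hq0).2 hq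
    refine ⟨p ++ q, (ih γ hγ (p ++ q) (fun _ => hpq) (fun _ => by simp [hq0]) ?_).mono ?_⟩
    · intro t ht
      rw [List.append_assoc, hc _ (by simp [hq0]), hq2 t ht]
    · rintro l ⟨v, h1, h2, h3, h4⟩
      have h5 : SPrefix p (p ++ q) := sprefix_append hq0
      refine ⟨v, h1, h5.1.trans h2, List.pairwise_cons.2 ⟨fun r hr => (h4 r hr).1, h3⟩, ?_⟩
      intro r hr
      rcases List.mem_cons.1 hr with rfl | hr
      · exact ⟨h5, hpq, h2⟩
      · exact ⟨h5.trans' (h4 r hr).1.1, (h4 r hr).2⟩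
  rw [WG_iff]
  refine ⟨?_, key⟩
  by_cases hβ : β = 0
  · refine ⟨p, ⟨hp (h0 hβ), ?_⟩, List.prefix_rfl, List.Pairwise.nil, by simp⟩
    rintro ⟨u, hu, ⟨t, rfl⟩, hne⟩
    have := (hc t (by rintro rfl; simp at hne)).1 hu
    rw [hβ, calT_zero] at this
    exact this
  · obtain ⟨s, hs⟩ := key 0 (pos_iff_ne_zero.2 hβ)
    obtain ⟨v, h1, h2, _⟩ := hs.nil
    exact ⟨v, h1, h2, List.Pairwise.nil, by simp⟩

/-- the list of moves along a branch -/
def plays {N : Type*} : (List Ordinal.{0} → N) → List Ordinal.{0} → List N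
  | _, [] => []
  | σ, a :: t => σ [a] :: plays (fun l => σ (a :: l)) t

theorem plays_mem {N : Type*} (v : List Ordinal.{0}) : ∀ (σ : List Ordinal.{0} → N)
    (t : List Ordinal.{0}), t ≠ [] → t <+: v → σ t ∈ plays σ v := by
  induction v with
  | nil => intro σ t ht h; simp_all
  | cons a v ih =>
    intro σ t ht h
    cases t with
    | nil => exact absurd rfl ht
    | cons b t =>
      rw [List.cons_prefix_cons] at h
      obtain ⟨rfl, h⟩ := h
      rw [plays]
      by_cases h0 : t = []
      · subst h0; simp
      · exact List.mem_cons_of_mem _ (ih (fun l => σ (b :: l)) t h0 h)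

theorem plays_pair {N : Type*} (R : N → N → Prop) (v : List Ordinal.{0}) :
    ∀ (σ : List Ordinal.{0} → N) (s t : List Ordinal.{0}), s ≠ [] → SPrefix s t → t <+: v →
    (plays σ v).Pairwise R → R (σ s) (σ t) := by
  induction v with
  | nil =>
    intro σ s t hs h1 h2 _
    have : t = [] := by simpa using h2
    subst this
    exact absurd (by simpa using h1.1) hs
  | cons a v ih =>
    intro σ s t hs h1 h2 h3
    rw [plays, List.pairwise_cons] at h3
    cases s with
    | nil => exact absurd rfl hs
    | cons b s =>
      cases t with
      | nil => exact absurd h1.1 (by simp)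
      | cons c t =>
        obtain ⟨h1, h1'⟩ := h1
        rw [List.cons_prefix_cons] at h1 h2
        obtain ⟨rfl, h1⟩ := h1
        obtain ⟨rfl, h2⟩ := h2
        have hst : s ≠ t := fun h => h1' (by rw [h])
        by_cases h0 : s = []
        · subst h0
          exact h3.1 _ (plays_mem v (fun l => σ (b :: l)) t hst.symm h2)
        · exact ih (fun l => σ (b :: l)) s t h0 ⟨h1, hst⟩ h2 h3.2

theorem strategy {N : Type*} [Nonempty N] (β : Ordinal.{0}) : ∀ Q : List N → Prop, WG β Q →
    ∃ σ : List Ordinal.{0} → N, ∀ t, (t = [] ∨ t ∈ calT β) → Q (plays σ t) := by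
  induction β using WellFoundedLT.induction with
  | ind β ih =>
  intro Q hW
  have key : ∀ γ, ∃ s : N, ∃ σ : List Ordinal.{0} → N, γ < β →
      ∀ t, (t = [] ∨ t ∈ calT γ) → Q (s :: plays σ t) := by
    intro γ
    by_cases hγ : γ < β
    · obtain ⟨s, hs⟩ := (WG_iff.1 hW).2 γ hγ
      obtain ⟨σ, hσ⟩ := ih γ hγ _ hs
      exact ⟨s, σ, fun _ => hσ⟩
    · exact ⟨Classical.arbitrary N, fun _ => Classical.arbitrary N, fun h => absurd h hγ⟩
  choose s σ h using key
  obtain ⟨pr, hpr⟩ : ∃ pr : Ordinal.{0} → Ordinal.{0}, ∀ γ, pr (γ + 1) = γ :=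
    ⟨Function.invFun (fun γ => γ + 1),
      Function.leftInverse_invFun (fun a b h => by simpa using h)⟩
  refine ⟨fun l => match l with
    | [] => Classical.arbitrary N
    | a :: t => if t = [] then s (pr a) else σ (pr a) t, ?_⟩
  intro t ht
  cases t with
  | nil => exact hW.nil
  | cons a t =>
    obtain ⟨γ, hγ, rfl, h2⟩ := cons_mem (ht.resolve_left (by simp))
    have e : pr (γ + 1) = γ := hpr γ
    have h3 := h γ hγ t h2
    rw [plays]
    simp only [e, if_true]
    convert h3 using 2
    have : ∀ (t : List Ordinal.{0}) (σ σ' : List Ordinal.{0} → N), (∀ l, l ≠ [] → σ l = σ' l) →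
        plays σ t = plays σ' t := by
      intro t
      induction t with
      | nil => intros; rfl
      | cons a t ih =>
        intro σ σ' h
        rw [plays, plays, h _ (by simp), ih _ _ fun l _ => h _ (by simp)]
    exact this _ _ _ fun l hl => by simp [hl]

/-- any coloring of `Λ^e(𝒯_{ω^{ω^ξ}})` by a finite set is constant on
the image of some extended monotone map of `𝒯_{ω^{ω^ξ}}` into itself. -/
theorem statement18 {C : Type*} [Finite C] (ξ : Ordinal.{0})
    (f : List Ordinal.{0} → List Ordinal.{0} → List Ordinal.{0} → C) :
    ∃ (x : C) (θ e : List Ordinal.{0} → List Ordinal.{0}),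
      ExtMonotoneTreeMap θ e (calT (omega0 ^ omega0 ^ ξ)) (calT (omega0 ^ omega0 ^ ξ)) ∧
      ∀ s t v, s ∈ calT (omega0 ^ omega0 ^ ξ) → t ∈ calT (omega0 ^ omega0 ^ ξ) →
        v ∈ MaxNodes (calT (omega0 ^ omega0 ^ ξ)) →
        SPrefix s t → t <+: v → f (θ s) (θ t) (e v) = x := by
  classical
  have hC : Nonempty C := ⟨f [] [] []⟩
  set α : Ordinal.{0} := omega0 ^ omega0 ^ ξ with hα
  have hα0 : α ≠ 0 := (opow_pos _ omega0_pos).ne'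
  let P : List (List Ordinal.{0}) → List Ordinal.{0} → Prop := fun l v =>
    v ∈ MaxNodes (calT α) ∧ l.Pairwise SPrefix ∧ ∀ s ∈ l, s ∈ calT α ∧ s <+: v
  have hP : Her P := fun l l' v hl h =>
    ⟨h.1, h.2.1.sublist hl, fun s hs => h.2.2 s (hl.subset hs)⟩
  have hW : WG α (fun l => ∃ v, P l v) := by
    refine (start α α [] (by simp) (fun h => absurd h hα0) (by simp)).mono ?_
    rintro l ⟨v, h1, _, h2, h3⟩
    exact ⟨v, h1, h2, fun s hs => (h3 s hs).2⟩
  obtain ⟨x, hx⟩ := main_game ξ f P hP hW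
  obtain ⟨σ, hσ⟩ := strategy _ _ hx
  have hσ' : ∀ t ∈ calT α, ∃ v, P (plays σ t) v ∧
      (plays σ t).Pairwise (fun s t => f s t v = x) := fun t ht => hσ t (Or.inr ht)
  choose! e he using hσ'
  have hne : ∀ t ∈ calT α, t ≠ [] := fun t ht h => nil_notMem α (h ▸ ht)
  refine ⟨x, σ, e, ⟨⟨?_, ?_⟩, ?_, ?_⟩, ?_⟩
  · intro t ht
    exact ((he t ht).1.2.2 _ (plays_mem t σ t (hne t ht) List.prefix_rfl)).1
  · intro s hs t ht hst
    exact plays_pair _ t σ s t (hne s hs) hst List.prefix_rfl (he t ht).1.2.1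
  · intro v hv
    exact (he v hv.1).1.1
  · intro v hv
    exact ((he v hv.1).1.2.2 _ (plays_mem v σ v (hne v hv.1) List.prefix_rfl)).2
  · intro s t v hs ht hv hst htv
    exact plays_pair (fun s t => f s t (e v) = x) v σ s t (hne s hs) hst htv (he v hv.1).2
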